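/- For θ ∈ (0, π/2) and c ≥ 0, ∫₀^θ (1 − (c/2)·tan²v)·sec³v dv = (1/(8 tan²θ))·(tan θ sec θ (2 sec²θ − 3) + (1 + 4 tan²θ)·log((1+tan(θ/2))/(1−tan(θ/2)))) when c = 2 + y and tan²θ = 2/(y+2), i.e. when c·tan²θ = 2. -/

import Mathlib

open Real

/-- The reduction formula for powers of the secant, in differential form. -/
lemma hasDerivAt_sin_div_cos_pow (n : ℕ) {x : ℝ} (hx : cos x ≠ 0) :
    HasDerivAt (fun v => sin v / cos v ^ (n + 1))
      ((n + 1) * (1 / cos x) ^ (n + 2) - n * (1 / cos x) ^ n) x := by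
  refine ((hasDerivAt_sin x).div ((hasDerivAt_cos x).pow (n + 1)) (pow_ne_zero _ hx)).congr_deriv ?_
  simp only [Nat.add_sub_cancel, Nat.cast_add, Nat.cast_one, Pi.pow_apply, one_div, inv_pow]
  field_simp
  rw [sin_sq]
  ring

lemma hasDerivAt_log_one_add_sin_div_cos {x : ℝ} (hx : cos x ≠ 0) :
    HasDerivAt (fun v => log ((1 + sin v) / cos v)) (1 / cos x) x := by
  have hs : 1 + sin x ≠ 0 := fun h => hx (by
    have := sin_sq_add_cos_sq x
    rw [show sin x = -1 by linarith] at this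
    nlinarith)
  refine ((((hasDerivAt_sin x).const_add 1).div (hasDerivAt_cos x) hx).log
    (div_ne_zero hs hx)).congr_deriv ?_
  simp only [Pi.div_apply]
  field_simp
  linear_combination sin_sq_add_cos_sq x

lemma one_add_sin_div_cos_eq_tan_half {x : ℝ} (hx : cos x ≠ 0) (hx' : cos (x / 2) ≠ 0) :
    (1 + sin x) / cos x = (1 + tan (x / 2)) / (1 - tan (x / 2)) := by
  have hs := sin_two_mul (x / 2)
  have hc := cos_two_mul' (x / 2)
  rw [mul_div_cancel₀ x two_ne_zero] at hs hc
  have hd : cos (x / 2) - sin (x / 2) ≠ 0 := fun h => hx (by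
    rw [hc]; linear_combination (cos (x / 2) + sin (x / 2)) * h)
  have ht : 1 - tan (x / 2) ≠ 0 := by
    rw [tan_eq_sin_div_cos, one_sub_div hx']
    exact div_ne_zero hd hx'
  rw [div_eq_div_iff hx ht, tan_eq_sin_div_cos, hs, hc]
  field_simp
  linear_combination (sin (x / 2) - cos (x / 2)) * sin_sq_add_cos_sq (x / 2)

/-- The closed form of `∫ (1 - a tan² v) sec³ v dv` between `0` and `θ`, for arbitrary `a`. -/
lemma integral_one_sub_mul_tan_sq_mul_sec_cube (a : ℝ) {θ : ℝ} (hθ : θ ∈ Set.Ico 0 (π / 2)) :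
    ∫ v in (0 : ℝ)..θ, (1 - a * tan v ^ 2) * (1 / cos v) ^ 3
      = (1 / 2 + a / 8) * (sin θ / cos θ ^ 2 + log ((1 + sin θ) / cos θ))
        - a / 4 * (sin θ / cos θ ^ 4) := by
  have hcos : ∀ v ∈ Set.uIcc 0 θ, cos v ≠ 0 := by
    intro v hv
    rw [Set.uIcc_of_le hθ.1] at hv
    exact (cos_pos_of_mem_Ioo ⟨by linarith [hv.1, pi_pos], by linarith [hv.2, hθ.2]⟩).ne'
  rw [intervalIntegral.integral_eq_sub_of_hasDerivAt
    (f := fun v => (1 / 2 + a / 8) * (sin v / cos v ^ 2 + log ((1 + sin v) / cos v))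
        - a / 4 * (sin v / cos v ^ 4))]
  · simp
  · intro v hv
    have hv := hcos v hv
    refine ((((hasDerivAt_sin_div_cos_pow 1 hv).add
      (hasDerivAt_log_one_add_sin_div_cos hv)).const_mul (1 / 2 + a / 8)).sub
      ((hasDerivAt_sin_div_cos_pow 3 hv).const_mul (a / 4))).congr_deriv ?_
    rw [tan_eq_sin_div_cos, div_pow (sin v), sin_sq]
    push_cast
    field_simp
    ring
  · refine ContinuousOn.intervalIntegrable fun v hv => ContinuousAt.continuousWithinAt ?_
    have hv := hcos v hv
    have := continuousAt_tan.2 hv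
    fun_prop (disch := assumption)

/-- For `θ ∈ (0, π/2)` and `c ≥ 0` with `c tan²θ = 2`:
`∫₀^θ (1 − (c/2) tan²v) sec³v dv = (1/(8 tan²θ))(tan θ sec θ (2 sec²θ − 3)
  + (1 + 4 tan²θ) log((1+tan(θ/2))/(1−tan(θ/2))))`. -/
theorem stmt_14 (θ c : ℝ) (hθ : θ ∈ Set.Ioo 0 (π/2)) (hc : 0 ≤ c)
    (hcθ : c * tan θ ^ 2 = 2) :
    ∫ v in (0:ℝ)..θ, (1 - c / 2 * tan v ^ 2) * (1 / cos v) ^ 3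
      = (1 / (8 * tan θ ^ 2)) *
        (tan θ * (1 / cos θ) * (2 * (1 / cos θ) ^ 2 - 3)
          + (1 + 4 * tan θ ^ 2) * Real.log ((1 + tan (θ/2)) / (1 - tan (θ/2)))) := by
  have hcos : cos θ ≠ 0 := (cos_pos_of_mem_Ioo ⟨by linarith [hθ.1, pi_pos], hθ.2⟩).ne'
  have hcos' : cos (θ / 2) ≠ 0 :=
    (cos_pos_of_mem_Ioo ⟨by linarith [hθ.1, pi_pos], by linarith [hθ.1, hθ.2]⟩).ne'
  have hsin : sin θ ≠ 0 := (sin_pos_of_pos_of_lt_pi hθ.1 (by linarith [hθ.2, pi_pos])).ne'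
  have htan : tan θ ≠ 0 := (tan_pos_of_pos_of_lt_pi_div_two hθ.1 hθ.2).ne'
  rw [integral_one_sub_mul_tan_sq_mul_sec_cube _ (Set.Ioo_subset_Ico_self hθ),
    ← one_add_sin_div_cos_eq_tan_half hcos hcos', eq_div_of_mul_eq (pow_ne_zero 2 htan) hcθ,
    tan_eq_sin_div_cos]
  generalize log ((1 + sin θ) / cos θ) = L
  field_simp
  rw [sin_sq]
  ring
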